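/- arXiv:2105.12490 — 2 statements merged into one kernel-verified Lean document; each statement's English description precedes it below -/
import Mathlib

section
/- Let n and k be positive integers with 1 ≤ k < n/2, and suppose there exists an integer i with 1 ≤ i ≤ k+1 such that (k+i) divides n. Then the power of cycle C_n^k satisfies the Total Coloring Conjecture, i.e., its total chromatic number satisfies χ''(C_n^k) ≤ Δ(C_n^k) + 2 = 2k + 2. -/
open SimpleGraph

/-- A total coloring of `G` with `t` colors: a vertex coloring `cv` and an edge coloring `ce`
such that adjacent vertices get distinct colors, distinct edges sharing an endpoint get
distinct colors, and every edge gets a color distinct from those of its endpoints. -/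
def IsTotalColoring {V : Type*} (G : SimpleGraph V) {t : ℕ}
    (cv : V → Fin t) (ce : Sym2 V → Fin t) : Prop :=
  (∀ u v : V, G.Adj u v → cv u ≠ cv v) ∧
  (∀ e₁ ∈ G.edgeSet, ∀ e₂ ∈ G.edgeSet, e₁ ≠ e₂ → (∃ u : V, u ∈ e₁ ∧ u ∈ e₂) →
    ce e₁ ≠ ce e₂) ∧
  (∀ e ∈ G.edgeSet, ∀ u : V, u ∈ e → ce e ≠ cv u)

/-- The total chromatic number of `G`. -/
noncomputable def totalChromaticNumber {V : Type*} (G : SimpleGraph V) : ℕ :=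
  sInf {t : ℕ | ∃ cv : V → Fin t, ∃ ce : Sym2 V → Fin t, IsTotalColoring G cv ce}

/-- The size of the color class of color `c`: vertices plus edges colored `c`. -/
noncomputable def totalClassSize {V : Type*} (G : SimpleGraph V) {t : ℕ}
    (cv : V → Fin t) (ce : Sym2 V → Fin t) (c : Fin t) : ℕ :=
  {v : V | cv v = c}.ncard + {e : Sym2 V | e ∈ G.edgeSet ∧ ce e = c}.ncard

/-- An equitable total coloring: a total coloring whose color class sizes pairwise differ
by at most one. -/
def IsEquitableTotalColoring {V : Type*} (G : SimpleGraph V) {t : ℕ}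
    (cv : V → Fin t) (ce : Sym2 V → Fin t) : Prop :=
  IsTotalColoring G cv ce ∧
  ∀ c c' : Fin t, totalClassSize G cv ce c ≤ totalClassSize G cv ce c' + 1

/-- The equitable total chromatic number of `G`. -/
noncomputable def equitableTotalChromaticNumber {V : Type*} (G : SimpleGraph V) : ℕ :=
  sInf {t : ℕ | ∃ cv : V → Fin t, ∃ ce : Sym2 V → Fin t, IsEquitableTotalColoring G cv ce}

/-- The color sum at a vertex `u`: the color of `u` plus the colors of all edges incident
with `u`, where color `c : Fin t` represents the integer color `c + 1 ∈ {1, …, t}`. -/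
noncomputable def nsdSum {V : Type*} (G : SimpleGraph V) {t : ℕ}
    (cv : V → Fin t) (ce : Sym2 V → Fin t) (u : V) : ℕ :=
  ((cv u : ℕ) + 1) + ∑ᶠ e ∈ G.incidenceSet u, ((ce e : ℕ) + 1)

/-- A neighborhood sum distinguishing total coloring: a total coloring such that adjacent
vertices have distinct color sums. -/
def IsNSDTotalColoring {V : Type*} (G : SimpleGraph V) {t : ℕ}
    (cv : V → Fin t) (ce : Sym2 V → Fin t) : Prop :=
  IsTotalColoring G cv ce ∧
  ∀ u v : V, G.Adj u v → nsdSum G cv ce u ≠ nsdSum G cv ce v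

/-- The neighborhood sum distinguishing total chromatic number of `G`. -/
noncomputable def nsdTotalChromaticNumber {V : Type*} (G : SimpleGraph V) : ℕ :=
  sInf {t : ℕ | ∃ cv : V → Fin t, ∃ ce : Sym2 V → Fin t, IsNSDTotalColoring G cv ce}

/-- The power of cycle `C_n^k`: vertices `ZMod n`, with `x ~ y` iff `x - y ≡ ±j (mod n)`
for some `1 ≤ j ≤ k`. -/
def powerOfCycle (n k : ℕ) : SimpleGraph (ZMod n) :=
  SimpleGraph.fromRel (fun x y => ∃ j : ℕ, 1 ≤ j ∧ j ≤ k ∧ x - y = (j : ZMod n))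

/-- The circulant graph `Cay(ZMod n, S)`: `x ~ y` iff `x - y ∈ S` (symmetrized). -/
def cayley (n : ℕ) (S : Finset (ZMod n)) : SimpleGraph (ZMod n) :=
  SimpleGraph.fromRel (fun x y => x - y ∈ S)

instance cayley.instDecidableRelAdj (n : ℕ) (S : Finset (ZMod n)) :
    DecidableRel (cayley n S).Adj :=
  fun x y => inferInstanceAs (Decidable (x ≠ y ∧ (x - y ∈ S ∨ y - x ∈ S)))

section Vizing

variable {V K : Type*}

/-- A partial proper edge coloring of `G`; `none` marks an uncolored pair. -/
structure IsPartialEdgeColoring (G : SimpleGraph V) (c : V → V → Option K) : Prop where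
  symm : ∀ u v, c u v = c v u
  adj : ∀ {u v a}, c u v = some a → G.Adj u v
  inj : ∀ {u v w a}, c u v = some a → c u w = some a → v = w

/-- The color `a` is not used at the vertex `u`. -/
def IsMissing (c : V → V → Option K) (u : V) (a : K) : Prop := ∀ v, c u v ≠ some a

/-- The number of colored ordered pairs. -/
noncomputable def coloredCount [Finite V] (c : V → V → Option K) : ℕ :=
  {p : V × V | c p.1 p.2 ≠ none}.ncard

/-- Two edge color classes, viewed as a graph. -/
def kempeGraph {G : SimpleGraph V} {c : V → V → Option K} (hc : IsPartialEdgeColoring G c)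
    (α β : K) : SimpleGraph V where
  Adj u v := c u v = some α ∨ c u v = some β
  symm := ⟨fun u v h => by rwa [hc.symm v u]⟩
  loopless := ⟨fun u h => by rcases h with h | h <;> exact (hc.adj h).ne rfl⟩

/-- A component of a graph of maximum degree two contains at most two vertices of degree at
most one. -/
theorem not_reachable_of_degree_le_one [Fintype V] (H : SimpleGraph V) [DecidableRel H.Adj]
    (h2 : ∀ v, H.degree v ≤ 2) {x y z : V} (hxy : x ≠ y) (hxz : x ≠ z) (hyz : y ≠ z)
    (hx : H.degree x ≤ 1) (hy : H.degree y ≤ 1) (hz : H.degree z ≤ 1)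
    (hyx : H.Reachable y x) : ¬ H.Reachable z x := by
  classical
  intro hzx
  let C := H.connectedComponentMk x
  have hC : C.toSimpleGraph.Connected := C.connected_toSimpleGraph
  have h1 := hC.card_vert_le_card_edgeSet_add_one
  have hs := C.toSimpleGraph.sum_degrees_eq_twice_card_edges
  have hdeg : ∀ v : C, C.toSimpleGraph.degree v ≤ H.degree v := by
    intro v
    rw [← card_neighborSet_eq_degree, ← card_neighborSet_eq_degree]
    refine Fintype.card_le_of_injective (fun w => ⟨w.1.1, ?_⟩) ?_
    · exact w.2
    · intro a b h
      exact Subtype.ext (Subtype.ext (Subtype.mk.inj h))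
  let X : C := ⟨x, rfl⟩
  let Y : C := ⟨y, ConnectedComponent.sound hyx⟩
  let Z : C := ⟨z, ConnectedComponent.sound hzx⟩
  have hsub : ∑ v : C, (C.toSimpleGraph.degree v + if v ∈ ({X, Y, Z} : Finset C) then 1 else 0)
      ≤ ∑ v : C, 2 := by
    refine Finset.sum_le_sum fun v _ => ?_
    have hv := hdeg v
    split_ifs with h
    · simp only [Finset.mem_insert, Finset.mem_singleton] at h
      rcases h with rfl | rfl | rfl
      · exact Nat.succ_le_succ (hv.trans hx)
      · exact Nat.succ_le_succ (hv.trans hy)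
      · exact Nat.succ_le_succ (hv.trans hz)
    · exact hv.trans (h2 _)
  have h3 : ({X, Y, Z} : Finset C).card = 3 := by
    rw [Finset.card_eq_three]
    exact ⟨X, Y, Z, fun h => hxy (congrArg Subtype.val h), fun h => hxz (congrArg Subtype.val h),
      fun h => hyz (congrArg Subtype.val h), rfl⟩
  rw [Finset.sum_add_distrib, hs, Finset.sum_ite_mem, Finset.univ_inter] at hsub
  simp only [Finset.sum_const, h3, Finset.card_univ, smul_eq_mul] at hsub
  rw [Nat.card_eq_fintype_card, Nat.card_eq_fintype_card, ← edgeFinset_card] at h1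
  omega

open Classical in
/-- Give the edge `xz` the color `a`. -/
noncomputable def recolor (c : V → V → Option K) (x z : V) (a : K) : V → V → Option K :=
  fun u v => if (u = x ∧ v = z) ∨ (u = z ∧ v = x) then some a else c u v

theorem recolor_self (c : V → V → Option K) (x z : V) (a : K) : recolor c x z a x z = some a := by
  simp [recolor]

theorem recolor_of_ne (c : V → V → Option K) {x z u : V} (a : K) (hx : u ≠ x) (hz : u ≠ z)
    (v : V) : recolor c x z a u v = c u v := by
  simp [recolor, hx, hz]

theorem recolor_left_of_ne (c : V → V → Option K) {x z v : V} (a : K) (hxz : x ≠ z)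
    (hv : v ≠ z) : recolor c x z a x v = c x v := by
  simp [recolor, hxz, hv]

theorem IsPartialEdgeColoring.recolor {G : SimpleGraph V} {c : V → V → Option K}
    (hc : IsPartialEdgeColoring G c) {x z : V} {a : K} (hxz : G.Adj x z)
    (hx : IsMissing c x a) (hz : IsMissing c z a) :
    IsPartialEdgeColoring G (recolor c x z a) where
  symm u v := by
    unfold _root_.recolor
    rw [hc.symm u v]
    congr 1
    apply propext
    tauto
  adj {u v b} h := by
    unfold _root_.recolor at h
    split_ifs at h with h1
    · rcases h1 with ⟨rfl, rfl⟩ | ⟨rfl, rfl⟩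
      exacts [hxz, hxz.symm]
    · exact hc.adj h
  inj {u v w b} h h' := by
    have hne := hxz.ne
    unfold _root_.recolor at h h'
    split_ifs at h h' with h1 h2 h2
    · grind
    · rcases h1 with ⟨rfl, rfl⟩ | ⟨rfl, rfl⟩
      · exact absurd (h'.trans h.symm) (hx w)
      · exact absurd (h'.trans h.symm) (hz w)
    · rcases h2 with ⟨rfl, rfl⟩ | ⟨rfl, rfl⟩
      · exact absurd (h.trans h'.symm) (hx v)
      · exact absurd (h.trans h'.symm) (hz v)
    · exact hc.inj h h'

theorem coloredCount_le [Finite V] {c c' : V → V → Option K}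
    (h : ∀ u v, c u v ≠ none → c' u v ≠ none) : coloredCount c ≤ coloredCount c' :=
  Set.ncard_le_ncard (fun p hp => h p.1 p.2 hp) (Set.toFinite _)

theorem coloredCount_lt [Finite V] {c c' : V → V → Option K}
    (h : ∀ u v, c u v ≠ none → c' u v ≠ none) {x y : V} (hxy : c x y = none)
    (hxy' : c' x y ≠ none) : coloredCount c < coloredCount c' :=
  Set.ncard_lt_ncard ⟨fun p hp => h p.1 p.2 hp,
    fun hs => hs (a := (x, y)) hxy' hxy⟩ (Set.toFinite _)

theorem recolor_ne_none (c : V → V → Option K) (x z : V) (a : K) (u v : V) (h : c u v ≠ none) :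
    recolor c x z a u v ≠ none := by
  unfold recolor
  split_ifs
  · simp
  · exact h

/-- A fan at `x`: distinct neighbors `y 0, …, y p` of `x` such that the edge to `y 0` is
uncolored and the color `a j` of the edge to `y (j + 1)` is missing at `y j`. -/
structure IsFan (G : SimpleGraph V) (c : V → V → Option K) (x : V) (y : ℕ → V) (a : ℕ → K)
    (p : ℕ) : Prop where
  adj : ∀ j ≤ p, G.Adj x (y j)
  root : c x (y 0) = none
  color : ∀ j < p, c x (y (j + 1)) = some (a j)
  missing : ∀ j < p, IsMissing c (y j) (a j)
  inj : ∀ i ≤ p, ∀ j ≤ p, y i = y j → i = j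

/-- If the last vertex of a fan misses a color missing at its center, shifting colors along
the fan colors one more edge. -/
theorem IsFan.exists_coloredCount_lt [Finite V] {G : SimpleGraph V} {x : V} {y : ℕ → V}
    {a : ℕ → K} (p : ℕ) : ∀ {c : V → V → Option K} {α : K}, IsPartialEdgeColoring G c →
    IsFan G c x y a p → IsMissing c x α → IsMissing c (y p) α →
    ∃ c' : V → V → Option K, IsPartialEdgeColoring G c' ∧ coloredCount c < coloredCount c' := by
  induction p with
  | zero =>
    intro c α hc hf hx hy
    refine ⟨_, hc.recolor (hf.adj 0 le_rfl) hx hy, ?_⟩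
    exact coloredCount_lt (recolor_ne_none c _ _ _) hf.root (by simp [recolor_self])
  | succ p ih =>
    intro c α hc hf hx hy
    have hadj := hf.adj (p + 1) le_rfl
    have hlast := hf.color p (Nat.lt_succ_self p)
    have hne : ∀ j ≤ p, y j ≠ y (p + 1) := fun j hj h => by
      have := hf.inj j (by omega) (p + 1) le_rfl h
      omega
    obtain ⟨c', hc', hlt⟩ := ih (α := a p) (hc.recolor hadj hx hy)
      { adj := fun j hj => hf.adj j (by omega)
        root := by rw [recolor_left_of_ne c α hadj.ne (hne 0 (by omega)), hf.root]
        color := fun j hj => by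
          rw [recolor_left_of_ne c α hadj.ne (hne (j + 1) (by omega)), hf.color j (by omega)]
        missing := fun j hj v => by
          rw [recolor_of_ne c α (hf.adj j (by omega)).ne' (hne j (by omega))]
          exact hf.missing j (by omega) v
        inj := fun i hi j hj => hf.inj i (by omega) j (by omega) }
      (by
        intro v hv
        by_cases h : v = y (p + 1)
        · rw [h, recolor_self] at hv
          exact hx _ (hlast.trans hv.symm)
        · rw [recolor_left_of_ne c α hadj.ne h] at hv
          exact h (hc.inj hv hlast))
      (by
        intro v
        rw [recolor_of_ne c α (hf.adj p (by omega)).ne' (hne p le_rfl)]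
        exact hf.missing p (by omega) v)
    exact ⟨c', hc', (coloredCount_le (recolor_ne_none c _ _ _)).trans_lt hlt⟩

open Classical in
/-- Exchange the colors `α` and `β` at the vertices of `s`. -/
noncomputable def kempeSwap (c : V → V → Option K) (s : Set V) (α β : K) :
    V → V → Option K :=
  fun u v => if u ∈ s then (c u v).map (Equiv.swap α β) else c u v

theorem kempeSwap_of_notMem (c : V → V → Option K) {s : Set V} (α β : K) {u : V} (hu : u ∉ s)
    (v : V) : kempeSwap c s α β u v = c u v := if_neg hu

theorem IsMissing.kempeSwap_of_mem {c : V → V → Option K} {s : Set V} {α β : K} {u : V}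
    (h : IsMissing c u β) (hu : u ∈ s) : IsMissing (kempeSwap c s α β) u α := by
  classical
  intro v hv
  rw [kempeSwap, if_pos hu, Option.map_eq_some_iff] at hv
  obtain ⟨b, hb, hba⟩ := hv
  rw [Equiv.swap_apply_eq_iff, Equiv.swap_apply_left] at hba
  exact h v (hba ▸ hb)

theorem IsMissing.kempeSwap_of_ne {c : V → V → Option K} {s : Set V} {α β γ : K} {u : V}
    (h : IsMissing c u γ) (hα : γ ≠ α) (hβ : γ ≠ β) : IsMissing (kempeSwap c s α β) u γ := by
  classical
  intro v hv
  unfold kempeSwap at hv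
  split_ifs at hv
  · rw [Option.map_eq_some_iff] at hv
    obtain ⟨b, hb, hba⟩ := hv
    rw [Equiv.swap_apply_eq_iff, Equiv.swap_apply_of_ne_of_ne hα hβ] at hba
    exact h v (hba ▸ hb)
  · exact h v hv

theorem coloredCount_kempeSwap [Finite V] (c : V → V → Option K) (s : Set V) (α β : K) :
    coloredCount c ≤ coloredCount (kempeSwap c s α β) := by
  refine coloredCount_le fun u v h => ?_
  unfold kempeSwap
  split_ifs
  · simpa using h
  · exact h

theorem IsPartialEdgeColoring.kempeSwap {G : SimpleGraph V} {c : V → V → Option K}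
    (hc : IsPartialEdgeColoring G c) {s : Set V} {α β : K}
    (hs : ∀ u v, c u v = some α ∨ c u v = some β → (u ∈ s ↔ v ∈ s)) :
    IsPartialEdgeColoring G (kempeSwap c s α β) where
  symm u v := by
    classical
    have key : ∀ u v, u ∈ s → v ∉ s → (c u v).map (Equiv.swap α β) = c u v := by
      intro u v hu hv
      cases h : c u v with
      | none => rfl
      | some b =>
        have h1 : b ≠ α := fun hb => hv ((hs u v (.inl (hb ▸ h))).1 hu)
        have h2 : b ≠ β := fun hb => hv ((hs u v (.inr (hb ▸ h))).1 hu)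
        rw [Option.map_some, Equiv.swap_apply_of_ne_of_ne h1 h2]
    unfold _root_.kempeSwap
    split_ifs with h1 h2 h2
    · rw [hc.symm]
    · rw [key u v h1 h2, hc.symm]
    · rw [key v u h2 h1, hc.symm]
    · rw [hc.symm]
  adj {u v b} h := by
    unfold _root_.kempeSwap at h
    split_ifs at h
    · rw [Option.map_eq_some_iff] at h
      obtain ⟨_, hb, _⟩ := h
      exact hc.adj hb
    · exact hc.adj h
  inj {u v w b} h h' := by
    unfold _root_.kempeSwap at h h'
    split_ifs at h h'
    · rw [Option.map_eq_some_iff] at h h'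
      obtain ⟨_, hb, rfl⟩ := h
      obtain ⟨_, hb', h⟩ := h'
      rw [(Equiv.injective _) h] at hb'
      exact hc.inj hb hb'
    · exact hc.inj h h'

theorem degree_kempeGraph_le_two [Fintype V] {G : SimpleGraph V} {c : V → V → Option K}
    (hc : IsPartialEdgeColoring G c) (α β : K) [DecidableRel (kempeGraph hc α β).Adj] (u : V) :
    (kempeGraph hc α β).degree u ≤ 2 := by
  classical
  by_contra! h
  obtain ⟨v₁, h₁, v₂, h₂, v₃, h₃, h12, h13, h23⟩ := Finset.two_lt_card.1 h
  rw [mem_neighborFinset] at h₁ h₂ h₃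
  rcases h₁ with h₁ | h₁ <;> rcases h₂ with h₂ | h₂ <;> rcases h₃ with h₃ | h₃ <;>
    first
    | exact h12 (hc.inj h₁ h₂)
    | exact h13 (hc.inj h₁ h₃)
    | exact h23 (hc.inj h₂ h₃)

theorem degree_kempeGraph_le_one [Fintype V] {G : SimpleGraph V} {c : V → V → Option K}
    (hc : IsPartialEdgeColoring G c) (α β : K) [DecidableRel (kempeGraph hc α β).Adj] {u : V}
    (hu : IsMissing c u α ∨ IsMissing c u β) : (kempeGraph hc α β).degree u ≤ 1 := by
  refine Finset.card_le_one.2 fun v hv w hw => ?_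
  rw [mem_neighborFinset] at hv hw
  rcases hu with hu | hu
  · exact hc.inj (hv.resolve_left (hu v)) (hw.resolve_left (hu w))
  · exact hc.inj (hv.resolve_right (hu v)) (hw.resolve_right (hu w))

/-- If two vertices of a fan miss the same color `β`, a Kempe exchange makes it possible to
color one more edge. -/
theorem IsFan.exists_coloredCount_lt_of_repeat [Finite V] {G : SimpleGraph V} {x : V}
    {y : ℕ → V} {a : ℕ → K} {p l : ℕ} {c : V → V → Option K} {α : K}
    (hc : IsPartialEdgeColoring G c) (hf : IsFan G c x y a p) (hx : IsMissing c x α)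
    (hl : l < p) (hp : IsMissing c (y p) (a l)) :
    ∃ c' : V → V → Option K, IsPartialEdgeColoring G c' ∧ coloredCount c < coloredCount c' := by
  classical
  have := Fintype.ofFinite V
  set β := a l with hβ
  have hneα : ∀ j < p, a j ≠ α := fun j hj h => hx _ (h ▸ hf.color j hj)
  have hneβ : ∀ j < p, j ≠ l → a j ≠ β := fun j hj hjl h => by
    have h1 := hf.color j hj
    rw [h] at h1
    have := hf.inj _ (by omega) _ (by omega) (hc.inj h1 (hf.color l hl))
    omega
  let H := kempeGraph hc α β
  have hcl : ∀ w u v, c u v = some α ∨ c u v = some β →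
      (u ∈ {u | H.Reachable w u} ↔ v ∈ {u | H.Reachable w u}) := fun w u v h =>
    ⟨fun hu => hu.trans (Adj.reachable (G := H) h),
      fun hv => hv.trans (Adj.reachable (G := H) h).symm⟩
  -- After an exchange off `x` that fixes what `y l` misses if needed, the fan survives.
  have key : ∀ r ≤ p, ¬ H.Reachable (y r) x → IsMissing c (y r) β →
      (l < r → ¬ H.Reachable (y r) (y l)) →
      ∃ c' : V → V → Option K, IsPartialEdgeColoring G c' ∧ coloredCount c < coloredCount c' := by
    intro r hr hrx hm hrl
    have hx' : x ∉ {u | H.Reachable (y r) u} := hrx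
    obtain ⟨c', hc', hlt⟩ := IsFan.exists_coloredCount_lt r (α := α) (x := x) (y := y) (a := a)
      (hc.kempeSwap (hcl (y r)))
      { adj := fun j hj => hf.adj j (by omega)
        root := by rw [kempeSwap_of_notMem c α β hx', hf.root]
        color := fun j hj => by rw [kempeSwap_of_notMem c α β hx', hf.color j (by omega)]
        missing := fun j hj => by
          by_cases hjl : j = l
          · subst hjl
            intro v
            rw [kempeSwap_of_notMem c α β (hrl hj)]
            exact hf.missing j hl v
          · exact (hf.missing j (by omega)).kempeSwap_of_ne (hneα j (by omega))
              (hneβ j (by omega) hjl)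
        inj := fun i hi j hj => hf.inj i (by omega) j (by omega) }
      (fun v => by rw [kempeSwap_of_notMem c α β hx']; exact hx v)
      (hm.kempeSwap_of_mem (Reachable.refl (G := H) (y r)))
    exact ⟨c', hc', (coloredCount_kempeSwap c _ α β).trans_lt hlt⟩
  by_cases hlx : H.Reachable (y l) x
  · have hlp : y l ≠ y p := fun h => by
      have := hf.inj l hl.le p le_rfl h
      omega
    have hpx : ¬ H.Reachable (y p) x :=
      not_reachable_of_degree_le_one H (degree_kempeGraph_le_two hc α β)
        (hf.adj l hl.le).ne (hf.adj p le_rfl).ne hlp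
        (degree_kempeGraph_le_one hc α β (.inl hx))
        (degree_kempeGraph_le_one hc α β (.inr (hf.missing l hl)))
        (degree_kempeGraph_le_one hc α β (.inr hp)) hlx
    exact key p le_rfl hpx hp fun _ h => hpx (h.trans hlx)
  · exact key l hl.le hlx (hf.missing l hl) fun h => absurd h (lt_irrefl l)

theorem exists_coloredCount_lt [Finite V] {G : SimpleGraph V} {c : V → V → Option K}
    (hc : IsPartialEdgeColoring G c) (hm : ∀ u, ∃ a, IsMissing c u a) {x y₀ : V}
    (hadj : G.Adj x y₀) (hnone : c x y₀ = none) :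
    ∃ c' : V → V → Option K, IsPartialEdgeColoring G c' ∧ coloredCount c < coloredCount c' := by
  classical
  by_contra hcon
  choose m hm using hm
  have hfan : ∀ p, ∃ y a, IsFan G c x y a p := by
    intro p
    induction p with
    | zero =>
      exact ⟨fun _ => y₀, fun _ => m x, fun _ _ => hadj, hnone, by simp, by simp,
        fun i hi j hj _ => by omega⟩
    | succ p ih =>
      obtain ⟨y, a, hf⟩ := ih
      have h1 : ¬ IsMissing c x (m (y p)) := fun h => hcon (hf.exists_coloredCount_lt p hc h (hm _))
      obtain ⟨z, hz⟩ : ∃ z, c x z = some (m (y p)) := by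
        simpa [IsMissing] using h1
      have hznew : ∀ j ≤ p, y j ≠ z := by
        rintro j hj rfl
        cases j with
        | zero => simp [hf.root] at hz
        | succ l =>
          have hl := hf.color l hj
          rw [hz, Option.some_inj] at hl
          exact hcon (hf.exists_coloredCount_lt_of_repeat hc (hm x) hj (hl ▸ hm (y p)))
      refine ⟨fun j => if j ≤ p then y j else z, fun j => if j < p then a j else m (y p),
        ⟨?_, ?_, ?_, ?_, ?_⟩⟩
      · intro j hj
        split_ifs with h
        exacts [hf.adj j h, hc.adj hz]
      · simpa using hf.root
      · intro j hj
        by_cases h : j < p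
        · simpa [h, Nat.succ_le_of_lt h] using hf.color j h
        · obtain rfl : j = p := by omega
          simpa using hz
      · intro j hj
        by_cases h : j < p
        · simpa [h, h.le] using hf.missing j h
        · obtain rfl : j = p := by omega
          simpa using hm (y j)
      · intro i hi j hj h
        split_ifs at h with h2 h3 h3
        · exact hf.inj i h2 j h3 h
        · exact absurd h (hznew i h2)
        · exact absurd h.symm (hznew j h3)
        · omega
  obtain ⟨y, a, hf⟩ := hfan (Nat.card V)
  have hinj : Function.Injective fun j : Fin (Nat.card V + 1) => y j := fun i j h =>
    Fin.ext (hf.inj i (by omega) j (by omega) h)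
  have := Nat.card_le_card_of_injective _ hinj
  simp at this

/-- `G` has a proper edge coloring with `t` colors. -/
def EdgeColorable (G : SimpleGraph V) (t : ℕ) : Prop :=
  ∃ c : V → V → Fin t, (∀ u v, c u v = c v u) ∧
    ∀ u v w, G.Adj u v → G.Adj u w → c u v = c u w → v = w

/-- Vizing's theorem. -/
theorem edgeColorable_of_degree_lt [Finite V] (G : SimpleGraph V) (t : ℕ)
    (hdeg : ∀ u, (G.neighborSet u).ncard < t) : EdgeColorable G t := by
  classical
  have := Fintype.ofFinite V
  have hne : {c : V → V → Option (Fin t) | IsPartialEdgeColoring G c}.Nonempty :=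
    ⟨fun _ _ => none, fun _ _ => rfl, by simp, by simp⟩
  obtain ⟨c, hc, hmax⟩ := Set.exists_max_image _ coloredCount (Set.toFinite _) hne
  have hm : ∀ u, ∃ a, IsMissing c u a := by
    intro u
    by_contra! h
    simp only [IsMissing, not_forall, not_not] at h
    choose v hv using h
    have hinj : Function.Injective fun a => (⟨v a, hc.adj (hv a)⟩ : G.neighborSet u) := by
      intro a b hab
      have hab' : v a = v b := congrArg Subtype.val hab
      have h1 := hv a
      rw [hab', hv b] at h1
      exact (Option.some_inj.1 h1).symm
    have h1 := Nat.card_le_card_of_injective _ hinj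
    rw [Nat.card_fin] at h1
    exact absurd (hdeg u) (not_lt.2 h1)
  have hall : ∀ u v, G.Adj u v → (c u v).isSome := by
    intro u v huv
    by_contra h
    obtain ⟨c', hc', hlt⟩ := exists_coloredCount_lt hc hm huv (by simpa using h)
    exact absurd (hmax c' hc') (not_le.2 hlt)
  rcases isEmpty_or_nonempty V with hV | ⟨⟨v₀⟩⟩
  · exact ⟨fun u => isEmptyElim u, fun u => isEmptyElim u, fun u => isEmptyElim u⟩
  · obtain ⟨a₀, -⟩ := hm v₀
    refine ⟨fun u v => (c u v).getD a₀, fun u v => congrArg (Option.getD · a₀) (hc.symm u v),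
      fun u v w hv hw h => ?_⟩
    obtain ⟨a, ha⟩ := Option.isSome_iff_exists.1 (hall u v hv)
    obtain ⟨b, hb⟩ := Option.isSome_iff_exists.1 (hall u w hw)
    simp only [ha, hb, Option.getD_some] at h
    exact hc.inj ha (h ▸ hb)

end Vizing

section EdgeColorable

variable {V : Type*}

theorem EdgeColorable.mono {G H : SimpleGraph V} {s t : ℕ} (hG : EdgeColorable H s) (hle : G ≤ H)
    (hst : s ≤ t) : EdgeColorable G t := by
  obtain ⟨c, hs, hc⟩ := hG
  refine ⟨fun u v => Fin.castLE hst (c u v), fun u v => congrArg _ (hs u v), ?_⟩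
  intro u v w hv hw h
  exact hc u v w (hle hv) (hle hw) (Fin.castLE_injective hst h)

theorem EdgeColorable.sup {G H : SimpleGraph V} {s t : ℕ} (hG : EdgeColorable G s)
    (hH : EdgeColorable H t) : EdgeColorable (G ⊔ H) (s + t) := by
  classical
  obtain ⟨c, hcs, hc⟩ := hG
  obtain ⟨d, hds, hd⟩ := hH
  refine ⟨fun u v => if G.Adj u v then Fin.castAdd t (c u v) else Fin.natAdd s (d u v),
    fun u v => ?_, ?_⟩
  · simp only [G.adj_comm u v, hcs u v, hds u v]
  · intro u v w hv hw h
    rw [sup_adj] at hv hw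
    dsimp only at h
    split_ifs at h with h1 h2 h2
    · exact hc u v w h1 h2 (Fin.castAdd_injective _ _ h)
    · exact absurd h (by simp [Fin.ext_iff]; omega)
    · exact absurd h (by simp [Fin.ext_iff]; omega)
    · exact hd u v w (hv.resolve_left h1) (hw.resolve_left h2) (Fin.natAdd_injective _ _ h)

/-- Total coloring from labels in `ℤ/N`, `N` odd: edges of `G₁` and vertices are colored by sums
of labels, the remaining edges by an edge coloring of `G₂`. -/
theorem totalChromaticNumber_le_of_labeling {G G₁ G₂ : SimpleGraph V} {N t : ℕ} (hN : Odd N)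
    (π : V → ZMod N) (hle : G ≤ G₁ ⊔ G₂) (hπ : ∀ u v, G.Adj u v → π u ≠ π v)
    (hG₁ : ∀ u v w, G₁.Adj u v → G₁.Adj u w → π v = π w → v = w) (hG₂ : EdgeColorable G₂ t) :
    totalChromaticNumber G ≤ N + t := by
  classical
  have : NeZero N := ⟨hN.pos.ne'⟩
  obtain ⟨d, hds, hd⟩ := hG₂
  let T : ZMod N → Fin N := fun a => ⟨a.val, ZMod.val_lt a⟩
  have hT : Function.Injective T := fun a b h => ZMod.val_injective N (Fin.mk.inj h)
  have hdbl : ∀ a b : ZMod N, a + a = b + b → a = b := by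
    intro a b h
    have h2 : IsUnit ((2 : ℕ) : ZMod N) := (ZMod.isUnit_iff_coprime 2 N).2 hN.coprime_two_left
    refine h2.mul_left_cancel ?_
    push_cast
    rw [two_mul, two_mul, h]
  let f : V → V → Fin (N + t) := fun u v =>
    if G₁.Adj u v then Fin.castAdd t (T (π u + π v)) else Fin.natAdd N (d u v)
  have hfs : ∀ u v, f u v = f v u := fun u v => by
    simp only [f, G₁.adj_comm u v, add_comm (π u), hds u v]
  refine Nat.sInf_le ⟨fun u => Fin.castAdd t (T (π u + π u)),
    Sym2.lift ⟨f, fun u v => hfs u v⟩, ?_, ?_, ?_⟩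
  · intro u v huv h
    exact hπ u v huv (hdbl _ _ (hT (Fin.castAdd_injective _ _ h)))
  · rintro e₁ he₁ e₂ he₂ hne ⟨u, ⟨v, rfl⟩, ⟨w, rfl⟩⟩ h
    rw [mem_edgeSet] at he₁ he₂
    have hv := hle he₁
    have hw := hle he₂
    rw [sup_adj] at hv hw
    apply hne
    congr 1
    simp only [Sym2.lift_mk, f] at h
    split_ifs at h with h1 h2 h2
    · exact hG₁ u v w h1 h2 (add_left_cancel (hT (Fin.castAdd_injective _ _ h)))
    · exact absurd h (by simp [Fin.ext_iff]; omega)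
    · exact absurd h (by simp [Fin.ext_iff]; omega)
    · exact hd u v w (hv.resolve_left h1) (hw.resolve_left h2) (Fin.natAdd_injective _ _ h)
  · rintro e he u ⟨v, rfl⟩ h
    rw [mem_edgeSet] at he
    simp only [Sym2.lift_mk, f] at h
    split_ifs at h with h1
    · exact hπ u v he (add_left_cancel (hT (Fin.castAdd_injective _ _ h))).symm
    · exact absurd h (by simp [Fin.ext_iff]; omega)

end EdgeColorable

section Circulant

variable {n : ℕ}

/-- The circulant graph on `ℤ/n` with differences in `S`. -/
def circulant (n : ℕ) (S : Finset ℕ) : SimpleGraph (ZMod n) :=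
  SimpleGraph.fromRel fun x y => ∃ j ∈ S, y = x + (j : ZMod n)

/-- The edges `{x, x + o}` with `P x`. -/
def shiftMatching (o : ℕ) (P : ZMod n → Prop) : SimpleGraph (ZMod n) :=
  SimpleGraph.fromRel fun x y => P x ∧ y = x + (o : ZMod n)

theorem powerOfCycle_eq_circulant (n k : ℕ) : powerOfCycle n k = circulant n (Finset.Icc 1 k) := by
  ext x y
  simp only [powerOfCycle, circulant, fromRel_adj, Finset.mem_Icc, and_assoc, sub_eq_iff_eq_add']
  rw [or_comm]

theorem exists_forall_adj_ne {V : Type*} [Finite V] {G : SimpleGraph V} {t : ℕ} {u : V}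
    (h : (G.neighborSet u).ncard < t) (c : V → V → Fin t) : ∃ a, ∀ v, G.Adj u v → c u v ≠ a := by
  by_contra! hcon
  choose v hv hvc using hcon
  have hinj : Function.Injective fun a => (⟨v a, hv a⟩ : G.neighborSet u) := by
    intro a b hab
    have hab' : v a = v b := congrArg Subtype.val hab
    rw [← hvc a, ← hvc b, hab']
  have h1 := Nat.card_le_card_of_injective _ hinj
  rw [Nat.card_fin] at h1
  exact absurd h (not_lt.2 h1)

theorem circulant_adj_add {S : Finset ℕ} {x y : ZMod n} (h : (circulant n S).Adj x y)
    (z : ZMod n) : (circulant n S).Adj (x + z) (y + z) := by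
  simp only [circulant, fromRel_adj] at h ⊢
  refine ⟨fun he => h.1 (add_right_cancel he), ?_⟩
  rcases h.2 with ⟨j, hj, rfl⟩ | ⟨j, hj, rfl⟩
  · exact .inl ⟨j, hj, by ring⟩
  · exact .inr ⟨j, hj, by ring⟩

theorem circulant_union (S T : Finset ℕ) :
    circulant n (S ∪ T) = circulant n S ⊔ circulant n T := by
  ext x y
  simp only [circulant, fromRel_adj, sup_adj, Finset.mem_union]
  grind

theorem exists_int_of_circulant_adj {S : Finset ℕ} {x y : ZMod n}
    (h : (circulant n S).Adj x y) : ∃ d : ℤ, d.natAbs ∈ S ∧ y = x + d := by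
  rcases h.2 with ⟨j, hj, rfl⟩ | ⟨j, hj, rfl⟩
  · exact ⟨j, by simpa using hj, by simp⟩
  · exact ⟨-j, by simpa using hj, by simp⟩

theorem ncard_neighborSet_circulant_lt [NeZero n] (S : Finset ℕ) (u : ZMod n) :
    ((circulant n S).neighborSet u).ncard < 2 * S.card + 1 := by
  classical
  refine Nat.lt_succ_of_le ?_
  have hsub : (circulant n S).neighborSet u ⊆
      ((S.image fun j : ℕ => u + (j : ZMod n)) ∪ (S.image fun j : ℕ => u - (j : ZMod n)) :
        Finset (ZMod n)) := by
    intro v hv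
    simp only [Finset.coe_union, Finset.coe_image, Set.mem_union, Set.mem_image, Finset.mem_coe]
    rcases hv.2 with ⟨j, hj, rfl⟩ | ⟨j, hj, rfl⟩
    · exact .inl ⟨j, hj, rfl⟩
    · exact .inr ⟨j, hj, by ring⟩
  calc _ ≤ _ := Set.ncard_le_ncard hsub (Set.toFinite _)
    _ ≤ S.card + S.card := by
        rw [Set.ncard_coe_finset]
        exact (Finset.card_union_le _ _).trans (add_le_add Finset.card_image_le
          Finset.card_image_le)
    _ = 2 * S.card := (two_mul _).symm

theorem edgeColorable_circulant [NeZero n] (S : Finset ℕ) :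
    EdgeColorable (circulant n S) (2 * S.card + 1) :=
  edgeColorable_of_degree_lt _ _ (ncard_neighborSet_circulant_lt S)

theorem edgeColorable_shiftMatching {o : ℕ} {P : ZMod n → Prop}
    (hP : ∀ x, P (x + o) ↔ ¬ P x) : EdgeColorable (shiftMatching o P) 1 := by
  refine ⟨fun _ _ => 0, fun _ _ => rfl, fun u v w hv hw _ => ?_⟩
  rcases hv.2 with ⟨h1, rfl⟩ | ⟨h1, rfl⟩ <;> rcases hw.2 with ⟨h2, h3⟩ | ⟨h2, h3⟩
  · exact h3.symm
  · subst h3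
    exact absurd h1 ((hP w).not.2 (not_not.2 h2))
  · exact absurd h2 ((hP v).not.2 (not_not.2 h1))
  · exact add_right_cancel h3

theorem circulant_singleton_le (o : ℕ) (P : ZMod n → Prop) :
    circulant n {o} ≤ shiftMatching o P ⊔ shiftMatching o fun x => ¬ P x := by
  intro x y
  simp only [circulant, shiftMatching, fromRel_adj, sup_adj, Finset.mem_singleton]
  grind

/-- A predicate on `ℤ/n` behaving like parity. -/
def IsParity (ev : ZMod n → Prop) : Prop := ∀ x (j : ℕ), ev (x + j) ↔ (ev x ↔ Even j)

theorem exists_isParity (hn : Even n) : ∃ ev : ZMod n → Prop, IsParity ev := by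
  let p := ZMod.castHom hn.two_dvd (ZMod 2)
  refine ⟨fun x => p x = 0, fun x j => ?_⟩
  simp only [map_add, map_natCast, ← ZMod.natCast_eq_zero_iff_even]
  generalize p x = a
  generalize (j : ZMod 2) = b
  revert a b
  decide

theorem IsParity.add_odd {ev : ZMod n → Prop} (hev : IsParity ev) {o : ℕ} (ho : Odd o)
    (x : ZMod n) : ev (x + o) ↔ ¬ ev x := by
  rw [hev, ← Nat.not_odd_iff_even]
  tauto

theorem IsParity.edgeColorable_sup_circulant_odd {ev : ZMod n → Prop} (hev : IsParity ev)
    {G : SimpleGraph (ZMod n)} {t : ℕ} (hG : EdgeColorable G t) (S : Finset ℕ)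
    (hS : ∀ j ∈ S, Odd j) : EdgeColorable (G ⊔ circulant n S) (t + 2 * S.card) := by
  induction S using Finset.induction_on with
  | empty =>
    refine hG.mono (sup_le le_rfl fun u v h => ?_) le_rfl
    simp [circulant] at h
  | insert o S ho ih =>
    have h1 := hev.add_odd (hS o (Finset.mem_insert_self o S))
    have h2 := (ih fun j hj => hS j (Finset.mem_insert_of_mem hj)).sup
      ((edgeColorable_shiftMatching h1).sup
        (edgeColorable_shiftMatching (P := fun x => ¬ ev x) fun x => not_congr (h1 x)))
    refine h2.mono ?_ (by rw [Finset.card_insert_of_notMem ho]; omega)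
    rw [Finset.insert_eq, circulant_union, sup_comm (circulant n {o}), ← sup_assoc]
    exact sup_le_sup_left (circulant_singleton_le o ev) _

/-- Even differences together with half of the edges of one odd difference: color the even and
the odd vertices alike, and use the missing colors on the edges between them. -/
theorem IsParity.edgeColorable_circulant_even_sup [NeZero n] {ev : ZMod n → Prop}
    (hev : IsParity ev) (S : Finset ℕ) (hS : ∀ j ∈ S, Even j) {o : ℕ} (ho : Odd o) :
    EdgeColorable (circulant n S ⊔ shiftMatching o ev) (2 * S.card + 1) := by
  classical
  obtain ⟨c, hcs, hc⟩ := edgeColorable_circulant (n := n) S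
  choose μ hμ using fun u => exists_forall_adj_ne (ncard_neighborSet_circulant_lt S u) c
  have hS' : ∀ u v, (circulant n S).Adj u v → (ev u ↔ ev v) := by
    intro u v h
    rcases h.2 with ⟨j, hj, rfl⟩ | ⟨j, hj, rfl⟩ <;> simp [hev _ j, hS j hj]
  have hM : ∀ u v, (shiftMatching o ev).Adj u v →
      (ev u ∧ ¬ ev v ∧ v = u + o) ∨ (¬ ev u ∧ ev v ∧ u = v + o) := by
    intro u v h
    rcases h.2 with ⟨h1, rfl⟩ | ⟨h1, rfl⟩ <;> simp [hev.add_odd ho, h1]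
  let f : ZMod n → ZMod n → Fin (2 * S.card + 1) := fun u v =>
    if ev u then (if ev v then c u v else μ u) else if ev v then μ v else c (u - o) (v - o)
  refine ⟨f, fun u v => ?_, fun u v w hv hw h => ?_⟩
  · simp only [f, hcs u v, hcs (u - o)]
    split_ifs <;> rfl
  · rw [sup_adj] at hv hw
    have hv' := hv.imp (fun h => (⟨hS' u v h, h⟩ : (ev u ↔ ev v) ∧ _)) (hM u v)
    have hw' := hw.imp (fun h => (⟨hS' u w h, h⟩ : (ev u ↔ ev w) ∧ _)) (hM u w)
    simp only [f] at h
    by_cases hu : ev u <;> by_cases h1 : ev v <;> by_cases h2 : ev w <;>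
      simp only [hu, h1, h2, if_true, if_false, iff_true, iff_false, not_true, not_false_eq_true,
        true_and, false_and, and_false, or_false, false_or] at h hv' hw'
    · exact hc u v w hv' hw' h
    · exact absurd h (hμ u v hv')
    · exact absurd h.symm (hμ u w hw')
    · rw [hv', hw']
    · exact add_right_cancel (hv'.symm.trans hw')
    · have := circulant_adj_add hw' (-(o : ZMod n))
      simp only [← sub_eq_add_neg] at this
      have hvo : v = u - o := by rw [hv', add_sub_cancel_right]
      rw [hvo] at h
      exact absurd h.symm (hμ _ _ this)
    · have := circulant_adj_add hv' (-(o : ZMod n))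
      simp only [← sub_eq_add_neg] at this
      have hwo : w = u - o := by rw [hw', add_sub_cancel_right]
      rw [hwo] at h
      exact absurd h (hμ _ _ this)
    · have h3 := circulant_adj_add hv' (-(o : ZMod n))
      have h4 := circulant_adj_add hw' (-(o : ZMod n))
      simp only [← sub_eq_add_neg] at h3 h4
      exact sub_left_injective (hc _ _ _ h3 h4 h)

theorem circulant_Icc_le {a b c : ℕ} : circulant n (Finset.Icc a c) ≤
    circulant n (Finset.Icc a b) ⊔ circulant n (Finset.Icc (b + 1) c) := by
  rw [← circulant_union]
  intro x y h
  refine ⟨h.1, h.2.imp ?_ ?_⟩ <;>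
  · rintro ⟨j, hj, rfl⟩
    refine ⟨j, ?_, rfl⟩
    simp only [Finset.mem_union, Finset.mem_Icc] at hj ⊢
    omega

/-- Differences `s + 1, …, k` and half of the difference `s` have a coloring with as many
colors as the degree, on an even number of vertices. -/
theorem exists_edgeColorable_half_sup [NeZero n] {s k : ℕ} (hs : 1 ≤ s) (hsk : s ≤ k)
    (hdvd : 2 * s ∣ n) : ∃ P : ZMod n → Prop, (∀ x, P (x + s) ↔ ¬ P x) ∧
      EdgeColorable (shiftMatching s P ⊔ circulant n (Finset.Icc (s + 1) k))
        (2 * (k - s) + 1) := by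
  classical
  obtain ⟨ev, hev⟩ := exists_isParity (even_iff_two_dvd.2 ((Dvd.intro s rfl).trans hdvd))
  set E := (Finset.Icc (s + 1) k).filter Even with hE
  set O := (Finset.Icc (s + 1) k).filter fun j => ¬ Even j with hO
  have hcard : E.card + O.card = k - s := by
    rw [Finset.card_filter_add_card_filter_not, Nat.card_Icc]
    omega
  have hEO : circulant n (Finset.Icc (s + 1) k) = circulant n E ⊔ circulant n O := by
    rw [← circulant_union, Finset.filter_union_filter_not_eq]
  have hEe : ∀ j ∈ E, Even j := fun j hj => (Finset.mem_filter.1 hj).2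
  have hOo : ∀ j ∈ O, Odd j := fun j hj => Nat.not_even_iff_odd.1 (Finset.mem_filter.1 hj).2
  rw [hEO]
  rcases Nat.even_or_odd s with hse | hso
  · have : NeZero (2 * s) := ⟨by omega⟩
    let p := ZMod.castHom hdvd (ZMod (2 * s))
    have hP : ∀ x, (p (x + s)).val < s ↔ ¬ (p x).val < s := by
      intro x
      have hlt := ZMod.val_lt (p x)
      rw [map_add, map_natCast, ZMod.val_add, ZMod.val_natCast, Nat.mod_eq_of_lt (a := s) (by omega)]
      by_cases h : (p x).val < s
      · rw [Nat.mod_eq_of_lt (by omega)]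
        omega
      · rw [Nat.mod_eq_sub_mod (by omega), Nat.mod_eq_of_lt (by omega)]
        omega
    refine ⟨fun x => (p x).val < s, hP, ?_⟩
    have hM := edgeColorable_shiftMatching (P := fun x => (p x).val < s) hP
    rcases hsk.eq_or_lt with rfl | hlt
    · refine hM.mono (sup_le le_rfl ?_) (by omega)
      rw [← hEO]
      intro u v h
      simp [circulant] at h
    · have ho : s + 1 ∈ O := by
        rw [hO, Finset.mem_filter, Finset.mem_Icc]
        exact ⟨⟨le_rfl, hlt⟩, by simpa [Nat.even_add_one] using hse⟩
      have hodd := hOo _ ho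
      have h1 := hev.add_odd hodd
      have h2 := hev.edgeColorable_sup_circulant_odd
        ((hM.sup (edgeColorable_shiftMatching (P := fun x => ¬ ev x)
          fun x => not_congr (h1 x))).sup
          (hev.edgeColorable_circulant_even_sup E hEe hodd)) (O.erase (s + 1))
        fun j hj => hOo j (Finset.mem_of_mem_erase hj)
      have hpos : 0 < O.card := Finset.card_pos.2 ⟨_, ho⟩
      refine h2.mono ?_ (by rw [Finset.card_erase_of_mem ho]; omega)
      have h3 : circulant n O = circulant n {s + 1} ⊔ circulant n (O.erase (s + 1)) := by
        rw [← circulant_union, ← Finset.insert_eq, Finset.insert_erase ho]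
      rw [h3]
      have h4 := circulant_singleton_le (n := n) (s + 1) ev
      intro u v huv
      have h5 := @h4 u v
      simp only [sup_adj] at huv h5 ⊢
      tauto
  · refine ⟨ev, hev.add_odd hso, ?_⟩
    refine (hev.edgeColorable_sup_circulant_odd (hev.edgeColorable_circulant_even_sup E hEe hso) O
      hOo).mono (le_of_eq ?_) (by omega)
    rw [← sup_assoc, sup_comm (shiftMatching s ev)]

theorem intCast_dvd_sub_of_castHom_eq {m : ℕ} (hdvd : m ∣ n) {u : ZMod n} {d d' : ℤ}
    (h : ZMod.castHom hdvd (ZMod m) (u + d) = ZMod.castHom hdvd (ZMod m) (u + d')) :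
    (m : ℤ) ∣ d - d' := by
  rw [map_add, map_add, map_intCast, map_intCast] at h
  exact (ZMod.intCast_eq_intCast_iff_dvd_sub _ _ _).1 (add_left_cancel h).symm

theorem castHom_ne_of_circulant_adj {m k : ℕ} (hdvd : m ∣ n) (hkm : k < m) {u v : ZMod n}
    (h : (circulant n (Finset.Icc 1 k)).Adj u v) :
    ZMod.castHom hdvd (ZMod m) u ≠ ZMod.castHom hdvd (ZMod m) v := by
  obtain ⟨d, hd, rfl⟩ := exists_int_of_circulant_adj h
  intro he
  rw [Finset.mem_Icc] at hd
  have h1 := intCast_dvd_sub_of_castHom_eq hdvd (u := u) (d := d) (d' := 0) (by simpa using he.symm)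
  rw [sub_zero] at h1
  have h2 := Int.eq_zero_of_abs_lt_dvd h1 (by rw [abs_lt]; omega)
  omega

theorem totalChromaticNumber_circulant_le_of_odd [NeZero n] {s k : ℕ} (hsk : s ≤ k)
    (hks : k < 2 * s + 1) (hdvd : 2 * s + 1 ∣ n) :
    totalChromaticNumber (circulant n (Finset.Icc 1 k)) ≤ 2 * k + 2 := by
  have hcol := edgeColorable_circulant (n := n) (Finset.Icc (s + 1) k)
  refine (totalChromaticNumber_le_of_labeling (odd_two_mul_add_one s)
    (ZMod.castHom hdvd (ZMod (2 * s + 1))) (circulant_Icc_le (b := s))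
    (fun u v => castHom_ne_of_circulant_adj hdvd hks) ?_ hcol).trans ?_
  · intro u v w hv hw h
    obtain ⟨d, hd, rfl⟩ := exists_int_of_circulant_adj hv
    obtain ⟨d', hd', rfl⟩ := exists_int_of_circulant_adj hw
    rw [Finset.mem_Icc] at hd hd'
    have h1 := Int.eq_zero_of_abs_lt_dvd (intCast_dvd_sub_of_castHom_eq hdvd h)
      (by rw [abs_lt]; push_cast; omega)
    rw [sub_eq_zero.1 h1]
  · rw [Nat.card_Icc]
    omega

theorem exists_int_of_circulant_sup_shiftMatching_adj {s : ℕ} (hs : 1 ≤ s) {P : ZMod n → Prop}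
    (hP : ∀ x, P (x + s) ↔ ¬ P x) {x y : ZMod n}
    (h : (circulant n (Finset.Icc 1 (s - 1)) ⊔ shiftMatching s fun x => ¬ P x).Adj x y) :
    ∃ d : ℤ, y = x + d ∧ (d.natAbs < s ∨ (d = s ∧ ¬ P x) ∨ (d = -s ∧ P x)) := by
  rw [sup_adj] at h
  rcases h with h | h
  · obtain ⟨d, hd, rfl⟩ := exists_int_of_circulant_adj h
    rw [Finset.mem_Icc] at hd
    exact ⟨d, rfl, .inl (by omega)⟩
  · rcases h.2 with ⟨h1, rfl⟩ | ⟨h1, rfl⟩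
    · exact ⟨s, by simp, .inr (.inl ⟨rfl, h1⟩)⟩
    · exact ⟨-s, by simp, .inr (.inr ⟨rfl, (hP y).2 h1⟩)⟩

theorem totalChromaticNumber_circulant_le_of_even [NeZero n] {s k : ℕ} (hs : 1 ≤ s) (hsk : s ≤ k)
    (hks : k < 2 * s) (hdvd : 2 * s ∣ n) :
    totalChromaticNumber (circulant n (Finset.Icc 1 k)) ≤ 2 * k + 2 := by
  have : NeZero (2 * s) := ⟨by omega⟩
  obtain ⟨P, hP, hcol⟩ := exists_edgeColorable_half_sup hs hsk hdvd
  let φ := ZMod.castHom hdvd (ZMod (2 * s))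
  have hinj : ∀ u v, ((φ u).val : ZMod (2 * s + 1)) = ((φ v).val : ZMod (2 * s + 1)) →
      φ u = φ v := by
    intro u v h
    have h1 := ZMod.val_lt (φ u)
    have h2 := ZMod.val_lt (φ v)
    rw [ZMod.natCast_eq_natCast_iff', Nat.mod_eq_of_lt (by omega), Nat.mod_eq_of_lt (by omega)] at h
    exact ZMod.val_injective _ h
  have hle : circulant n (Finset.Icc 1 k) ≤
      (circulant n (Finset.Icc 1 (s - 1)) ⊔ shiftMatching s fun x => ¬ P x) ⊔
        (shiftMatching s P ⊔ circulant n (Finset.Icc (s + 1) k)) := by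
    intro u v huv
    have h1 := circulant_Icc_le (b := s) huv
    have h2 := @circulant_Icc_le n 1 (s - 1) s u v
    have h3 := @circulant_singleton_le n s P u v
    rw [Nat.sub_add_cancel hs, Finset.Icc_self] at h2
    simp only [sup_adj] at h1 h2 h3 ⊢
    tauto
  refine (totalChromaticNumber_le_of_labeling (odd_two_mul_add_one s)
    (fun u => ((φ u).val : ZMod (2 * s + 1))) hle
    (fun u v huv h => castHom_ne_of_circulant_adj hdvd hks huv (hinj u v h)) ?_ hcol).trans
    (by omega)
  intro u v w hv hw h
  obtain ⟨d, rfl, hd⟩ := exists_int_of_circulant_sup_shiftMatching_adj hs hP hv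
  obtain ⟨d', rfl, hd'⟩ := exists_int_of_circulant_sup_shiftMatching_adj hs hP hw
  have h1 := Int.eq_zero_of_abs_lt_dvd (intCast_dvd_sub_of_castHom_eq hdvd (hinj _ _ h)) (by
    rw [abs_lt]
    push_cast
    rcases hd with hd | ⟨rfl, hd⟩ | ⟨rfl, hd⟩ <;> rcases hd' with hd' | ⟨rfl, hd'⟩ | ⟨rfl, hd'⟩ <;>
      first | omega | exact absurd ‹P u› ‹¬ P u›)
  rw [sub_eq_zero.1 h1]

end Circulant

/-- Theorem 2.1 (TCC part): if `1 ≤ k < n/2` and `(k+i) ∣ n` for some `1 ≤ i ≤ k+1`, then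
`C_n^k` satisfies the Total Coloring Conjecture: `χ''(C_n^k) ≤ Δ + 2 = 2k + 2`. -/
theorem powerOfCycle_tcc (n k : ℕ) (hk : 1 ≤ k) (hkn : 2 * k < n)
    (i : ℕ) (hi1 : 1 ≤ i) (hi2 : i ≤ k + 1) (hdvd : (k + i) ∣ n) :
    totalChromaticNumber (powerOfCycle n k) ≤ 2 * k + 2 := by
  have : NeZero n := ⟨by omega⟩
  rw [powerOfCycle_eq_circulant]
  rcases Nat.even_or_odd' (k + i) with ⟨s, hs | hs⟩
  · exact totalChromaticNumber_circulant_le_of_even (by omega) (by omega) (by omega) (hs ▸ hdvd)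
  · exact totalChromaticNumber_circulant_le_of_odd (by omega) (by omega) (hs ▸ hdvd)
end

section
/- Let n be an even positive integer and let G = Cay(Z_n, S) be a circulant graph whose symmetric connection set S ⊆ Z_n \ {0} satisfies: (i) n/2 ∉ S; (ii) there is a symmetric subset M ⊆ S with |M| = n/2 − 2 such that m + m' ≠ n/2 (mod n) for all m, m' ∈ M; and (iii) the set S \ M generates the group Z_n. Then the total chromatic number of G satisfies χ''(G) ≤ Δ(G) + 3. -/
open SimpleGraph

/-- To bound the total chromatic number by `t`, it suffices to give a vertex coloring and a
coloring of ordered pairs, symmetric on adjacent pairs, whose colors lie in a finite set of at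
most `t` elements. -/
theorem totalChromaticNumber_le_of_coloring {V β : Type*} (G : SimpleGraph V) {t : ℕ} [NeZero t]
    (T : Finset β) (hT : T.card ≤ t) (cv : V → β) (ce : V → V → β)
    (hcv : ∀ x, cv x ∈ T) (hce : ∀ x y, G.Adj x y → ce x y ∈ T)
    (hsymm : ∀ x y, G.Adj x y → ce x y = ce y x)
    (hvert : ∀ x y, G.Adj x y → cv x ≠ cv y)
    (hedge : ∀ x y z, G.Adj x y → G.Adj x z → y ≠ z → ce x y ≠ ce x z)
    (hinc : ∀ x y, G.Adj x y → ce x y ≠ cv x) :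
    totalChromaticNumber G ≤ t := by
  classical
  obtain ⟨f, hf⟩ : ∃ f : β → Fin t, Set.InjOn f T := by
    obtain ⟨e⟩ : Nonempty (T ↪ Fin t) :=
      Function.Embedding.nonempty_of_card_le (by simpa using hT)
    refine ⟨fun b => if hb : b ∈ T then e ⟨b, hb⟩ else 0, fun a ha b hb hab => ?_⟩
    rw [Finset.mem_coe] at ha hb
    simpa [ha, hb] using hab
  have hout : ∀ x y, G.Adj x y → ce (Quot.out s(x, y)).1 (Quot.out s(x, y)).2 = ce x y := by
    intro x y hxy
    have h : s((Quot.out s(x, y)).1, (Quot.out s(x, y)).2) = s(x, y) := Quot.out_eq s(x, y)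
    rcases Sym2.eq_iff.1 h with ⟨h₁, h₂⟩ | ⟨h₁, h₂⟩
    · rw [h₁, h₂]
    · rw [h₁, h₂, hsymm x y hxy]
  refine Nat.sInf_le ⟨fun x => f (cv x), fun e => f (ce (Quot.out e).1 (Quot.out e).2),
    fun u v huv h => hvert u v huv (hf (hcv u) (hcv v) h), ?_, ?_⟩
  · rintro e₁ he₁ e₂ he₂ hne ⟨u, hu₁, hu₂⟩ h
    obtain ⟨v, rfl⟩ := hu₁
    obtain ⟨w, rfl⟩ := hu₂
    rw [mem_edgeSet] at he₁ he₂
    simp only [hout _ _ he₁, hout _ _ he₂] at h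
    exact hedge u v w he₁ he₂ (fun hvw => hne (by rw [hvw]))
      (hf (hce _ _ he₁) (hce _ _ he₂) h)
  · rintro e he u hu h
    obtain ⟨v, rfl⟩ := hu
    rw [mem_edgeSet] at he
    simp only [hout _ _ he] at h
    exact hinc u v he (hf (hce _ _ he) (hcv u) h)

/-- A coloring of `ZMod n` by two colors in which elements differing by `r` get different
colors. -/
def IsAntiperiodic {n : ℕ} (r : ZMod n) (f : ZMod n → Bool) : Prop :=
  ∀ x y, (y - x = r ∨ x - y = r) → f x ≠ f y

theorem isAntiperiodic_neg {n : ℕ} (r : ZMod n) : IsAntiperiodic (-r) = IsAntiperiodic r := by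
  have h : ∀ x y : ZMod n, (y - x = -r ∨ x - y = -r) ↔ (y - x = r ∨ x - y = r) := by
    intro x y
    rw [eq_neg_iff_add_eq_zero, eq_neg_iff_add_eq_zero, ← sub_eq_zero (b := r),
      ← sub_eq_zero (b := r), ← neg_eq_zero (a := y - x + r), ← neg_eq_zero (a := x - y + r)]
    ring_nf
    tauto
  funext f
  simp only [IsAntiperiodic, h]

/-- Elements of even order of `ZMod n` admit an antiperiodic two-coloring. -/
theorem exists_isAntiperiodic {n a m : ℕ} [NeZero n] (hnm : n = 2 ^ a * m) (r : ZMod n)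
    (hr : (m : ZMod n) * r ≠ 0) : ∃ f, IsAntiperiodic r f := by
  have hr0 : r.val ≠ 0 := fun h => hr (by rw [(ZMod.val_eq_zero r).1 h, mul_zero])
  obtain ⟨b, u, hu, hru⟩ := Nat.exists_eq_two_pow_mul_odd hr0
  have hba : b < a := by
    by_contra! hab
    apply hr
    rw [← ZMod.natCast_zmod_val r, ← Nat.cast_mul, ZMod.natCast_eq_zero_iff, hru]
    obtain ⟨c, rfl⟩ := Nat.exists_eq_add_of_le hab
    exact ⟨2 ^ c * u, by rw [hnm]; ring⟩
  obtain ⟨c, rfl⟩ := Nat.exists_eq_add_of_lt hba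
  have key : ∀ x : ZMod n, (x + r).val / 2 ^ b % 2 = (x.val / 2 ^ b + u) % 2 := by
    intro x
    have hn' : n = 2 ^ b * (2 * (2 ^ c * m)) := by rw [hnm]; ring
    rw [ZMod.val_add, hru]
    conv_lhs => rw [show (x.val + 2 ^ b * u) % n
      = (x.val + 2 ^ b * u) % (2 ^ b * (2 * (2 ^ c * m))) by rw [← hn']]
    rw [Nat.mod_mul_right_div_self, Nat.mod_mul_right_mod,
      Nat.add_mul_div_left _ _ (by positivity)]
  have key' : ∀ x : ZMod n,
      decide (x.val / 2 ^ b % 2 = 0) ≠ decide ((x + r).val / 2 ^ b % 2 = 0) := by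
    intro x
    have := key x
    obtain ⟨k, rfl⟩ := hu
    intro h
    rw [decide_eq_decide] at h
    omega
  refine ⟨fun x => decide (x.val / 2 ^ b % 2 = 0), fun x y hxy => ?_⟩
  rcases hxy with h | h
  · rw [← sub_add_cancel y x, h, add_comm]
    exact key' x
  · rw [← sub_add_cancel x y, h, add_comm]
    exact (key' y).symm

/-- A set closed under a negation without fixed points has even cardinality. -/
theorem even_card_of_neg_mem {A : Type*} [AddGroup A] (M : Finset A)
    (hM : ∀ a ∈ M, -a ∈ M) (hfix : ∀ a ∈ M, -a ≠ a) : Even M.card := by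
  have h : ∑ _a ∈ M, (1 : ZMod 2) = 0 :=
    Finset.sum_involution (fun a _ => -a) (fun _ _ => by decide) (fun a ha _ => hfix a ha)
      (fun a ha => hM a ha) (fun a _ => neg_neg a)
  rw [Finset.sum_const, nsmul_one, ZMod.natCast_eq_zero_iff] at h
  exact even_iff_two_dvd.2 h

theorem cayley_adj_iff {n : ℕ} {S : Finset (ZMod n)} (hsym : ∀ s ∈ S, -s ∈ S)
    (h0 : (0 : ZMod n) ∉ S) (x y : ZMod n) : (cayley n S).Adj x y ↔ y - x ∈ S := by
  have hneg : x - y ∈ S → y - x ∈ S := fun h => by simpa using hsym _ h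
  simp only [cayley, fromRel_adj]
  refine ⟨fun h => h.2.elim hneg id, fun h => ⟨?_, Or.inr h⟩⟩
  rintro rfl
  exact h0 (by simpa using h)

/-- Two residues modulo `2 * h` with the same remainder modulo `h` are equal or antipodal. -/
theorem eq_or_sub_eq_half {h : ℕ} [NeZero (2 * h)] {x y : ZMod (2 * h)}
    (hxy : x.val % h = y.val % h) : y - x = 0 ∨ y - x = (h : ZMod (2 * h)) := by
  have hx := ZMod.val_lt x
  have hy := ZMod.val_lt y
  have hpos : 0 < h := Nat.pos_of_ne_zero fun h0 => NeZero.ne (2 * h) (by omega)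
  have hzero : (h : ZMod (2 * h)) + h = 0 := by
    rw [← two_mul]; exact_mod_cast ZMod.natCast_self (2 * h)
  have hxd := Nat.mod_add_div x.val h
  have hyd := Nat.mod_add_div y.val h
  have hx2 : x.val / h < 2 := Nat.div_lt_of_lt_mul (by linarith)
  have hy2 : y.val / h < 2 := Nat.div_lt_of_lt_mul (by linarith)
  rw [hxy] at hxd
  rw [← ZMod.natCast_zmod_val x, ← ZMod.natCast_zmod_val y, ← hxd, ← hyd]
  generalize x.val / h = i at *
  generalize y.val / h = j at *
  interval_cases i <;> interval_cases j <;> simp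
  right
  linear_combination -hzero

theorem eq_zero_or_eq_half {h : ℕ} [NeZero (2 * h)] {x : ZMod (2 * h)} (hx : -x = x) :
    x = 0 ∨ x = (h : ZMod (2 * h)) := by
  have hd : ((2 * x.val : ℕ) : ZMod (2 * h)) = 0 := by
    push_cast
    rw [ZMod.natCast_zmod_val]
    linear_combination -hx
  rw [ZMod.natCast_eq_zero_iff] at hd
  have hxy : (0 : ZMod (2 * h)).val % h = x.val % h := by
    rw [ZMod.val_zero, Nat.zero_mod]
    exact (Nat.mod_eq_zero_of_dvd (Nat.dvd_of_mul_dvd_mul_left two_pos hd)).symm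
  simpa using eq_or_sub_eq_half hxy

/-- If the symmetric set `M` contains no two antipodal elements and `S \ M` consists of
elements of even order,
then `Cay(ZMod (2 * h), S)` has a total coloring with `h + 1 + |S \ M|` colors. -/
theorem totalChromaticNumber_cayley_le {h a m t : ℕ} [NeZero (2 * h)] [NeZero t]
    (hheven : Even h) (hnm : 2 * h = 2 ^ a * m) {S M : Finset (ZMod (2 * h))}
    (hsym : ∀ s ∈ S, -s ∈ S) (h0 : (0 : ZMod (2 * h)) ∉ S) (hinv : (h : ZMod (2 * h)) ∉ S)
    (hMsym : ∀ a ∈ M, -a ∈ M)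
    (hMsum : ∀ a ∈ M, ∀ b ∈ M, a + b ≠ (h : ZMod (2 * h)))
    (hR : ∀ r ∈ S \ M, (m : ZMod (2 * h)) * r ≠ 0) (ht : h + 1 + (S \ M).card ≤ t) :
    totalChromaticNumber (cayley (2 * h) S) ≤ t := by
  classical
  have hadj := cayley_adj_iff hsym h0
  have hMneg : ∀ x y : ZMod (2 * h), y - x ∈ M ↔ x - y ∈ M := fun x y =>
    ⟨fun H => by simpa using hMsym _ H, fun H => by simpa using hMsym _ H⟩
  have hSneg : ∀ x y : ZMod (2 * h), y - x ∈ S ↔ x - y ∈ S := fun x y =>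
    ⟨fun H => by simpa using hsym _ H, fun H => by simpa using hsym _ H⟩
  let P : ZMod (2 * h) → ZMod (2 * h) → Bool := fun r => Classical.epsilon (IsAntiperiodic r)
  have hPneg : ∀ x y, P (y - x) = P (x - y) := fun x y => by
    simp only [P]
    rw [← neg_sub x y, isAntiperiodic_neg]
  have hP : ∀ x y, y - x ∈ S → y - x ∉ M → P (y - x) x ≠ P (y - x) y := fun x y hS hM =>
    Classical.epsilon_spec (exists_isAntiperiodic hnm (y - x)
      (hR _ (Finset.mem_sdiff.2 ⟨hS, hM⟩))) x y (Or.inl rfl)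
  have hpos : 0 < h := Nat.pos_of_ne_zero fun h0 => NeZero.ne (2 * h) (by omega)
  let g : ZMod (2 * h) → ZMod (h + 1) := fun x => ((x.val % h : ℕ) : ZMod (h + 1))
  have hg : ∀ x y, g x = g y → y - x = 0 ∨ y - x = (h : ZMod (2 * h)) := by
    intro x y hxy
    refine eq_or_sub_eq_half ?_
    have hxy' := (ZMod.natCast_eq_natCast_iff' _ _ _).1 hxy
    have hx := Nat.mod_lt x.val hpos
    have hy := Nat.mod_lt y.val hpos
    rwa [Nat.mod_eq_of_lt (hx.trans h.lt_succ_self),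
      Nat.mod_eq_of_lt (hy.trans h.lt_succ_self)] at hxy'
  have hgS : ∀ x y, y - x ∈ S → g x ≠ g y := fun x y hS hxy => by
    rcases hg x y hxy with H | H
    · exact h0 (H ▸ hS)
    · exact hinv (H ▸ hS)
  have htwo : ∀ u v : ZMod (h + 1), u + u = v + v → u = v := by
    intro u v huv
    have hunit : IsUnit ((2 : ℕ) : ZMod (h + 1)) :=
      (ZMod.isUnit_iff_coprime 2 (h + 1)).2 (Nat.coprime_two_left.2 hheven.add_one)
    refine hunit.mul_left_cancel ?_
    push_cast
    linear_combination huv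
  refine totalChromaticNumber_le_of_coloring (cayley (2 * h) S)
    ((Finset.univ : Finset (ZMod (h + 1))).disjSum (S \ M)) ?_
    (fun x => Sum.inl (g x + g x))
    (fun x y => if y - x ∈ M then Sum.inl (g x + g y)
      else Sum.inr (if P (y - x) x then y - x else x - y)) ?_ ?_ ?_ ?_ ?_ ?_
  · simpa [Finset.card_disjSum, ZMod.card] using ht
  · intro x
    simp
  · intro x y hxy
    rw [hadj] at hxy
    by_cases hM : y - x ∈ M
    · simp [hM]
    · have hM' := (hMneg x y).not.1 hM
      have hS' := (hSneg x y).1 hxy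
      simp only [hM, if_false, Finset.inr_mem_disjSum, Finset.mem_sdiff]
      split_ifs <;> exact ⟨by assumption, by assumption⟩
  · intro x y hxy
    rw [hadj] at hxy
    by_cases hM : y - x ∈ M
    · simp [hM, (hMneg x y).1 hM, add_comm]
    · have := hP x y hxy hM
      simp only [hM, (hMneg x y).not.1 hM, if_false, ← hPneg x y]
      cases hx : P (y - x) x <;> cases hy : P (y - x) y <;> simp_all
  · intro x y hxy H
    rw [hadj] at hxy
    exact hgS x y hxy (htwo _ _ (Sum.inl_injective H))
  · intro x y z hxy hxz hyz H
    rw [hadj] at hxy hxz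
    by_cases hMy : y - x ∈ M <;> by_cases hMz : z - x ∈ M <;>
      simp only [hMy, hMz, if_true, if_false, Sum.inl.injEq, Sum.inr.injEq, add_right_inj,
        reduceCtorEq] at H
    · rcases hg y z H with H' | H'
      · exact hyz (sub_eq_zero.1 H').symm
      · refine hMsum _ hMz _ ((hMneg x y).1 hMy) ?_
        rw [← H']; ring
    · have hPy := hP x y hxy hMy
      have hcases : y - x = z - x ∨ y - x = x - z := by
        split_ifs at H
        · exact Or.inl H
        · exact Or.inr H
        · exact Or.inr (by linear_combination -H)
        · exact Or.inl (by linear_combination -H)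
      rcases hcases with H' | H'
      · exact hyz (sub_left_injective H')
      · have hPP : P (y - x) = P (z - x) := by rw [H', ← hPneg]
        rw [hPP] at H
        split_ifs at H
        · exact hyz (sub_left_injective H)
        · exact hyz (sub_right_injective H)
  · intro x y hxy H
    rw [hadj] at hxy
    by_cases hM : y - x ∈ M <;>
      simp only [hM, if_true, if_false, Sum.inl.injEq, add_right_inj, reduceCtorEq] at H
    exact hgS x y hxy H.symm

/-- The subset `M` may be exchanged for one of the same size that contains all elements of `S`
of odd order, by replacing elements with their antipodes. -/
theorem exists_exchange {h m : ℕ} [NeZero (2 * h)] (hm : Odd m) {S M : Finset (ZMod (2 * h))}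
    (hsym : ∀ s ∈ S, -s ∈ S) (h0 : (0 : ZMod (2 * h)) ∉ S) (hinv : (h : ZMod (2 * h)) ∉ S)
    (hMS : M ⊆ S) (hMsym : ∀ a ∈ M, -a ∈ M) (hMcard : M.card = h - 2)
    (hMsum : ∀ a ∈ M, ∀ b ∈ M, a + b ≠ (h : ZMod (2 * h))) :
    ∃ N ⊆ S, (∀ a ∈ N, -a ∈ N) ∧ N.card = M.card ∧
      (∀ a ∈ N, ∀ b ∈ N, a + b ≠ (h : ZMod (2 * h))) ∧
      ∀ r ∈ S \ N, (m : ZMod (2 * h)) * r ≠ 0 := by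
  classical
  have hpos : 0 < h := Nat.pos_of_ne_zero fun h0 => NeZero.ne (2 * h) (by omega)
  have hzero : (h : ZMod (2 * h)) + h = 0 := by
    rw [← two_mul]; exact_mod_cast ZMod.natCast_self (2 * h)
  have hne : (h : ZMod (2 * h)) ≠ 0 := by
    rw [Ne, ZMod.natCast_eq_zero_iff]
    exact fun H => by have := Nat.le_of_dvd hpos H; omega
  have hmh : (m : ZMod (2 * h)) * h = h := by
    obtain ⟨k, rfl⟩ := hm
    push_cast
    linear_combination (k : ZMod (2 * h)) * hzero
  have hMdiff : ∀ a ∈ M, ∀ b ∈ M, a ≠ b + h := fun a ha b hb H =>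
    hMsum a ha (-b) (hMsym b hb) (by rw [H]; ring)
  have hcover : ∀ r ∈ S, (m : ZMod (2 * h)) * r = 0 → r ∈ M ∨ r + h ∈ M := by
    intro r hr hmr
    by_contra! hcon
    obtain ⟨hrM, hrhM⟩ := hcon
    have hr0 : r ≠ 0 := fun H => h0 (H ▸ hr)
    have hrh : r ≠ h := fun H => hinv (H ▸ hr)
    have hrneg : r ≠ -r := by
      intro H
      rcases eq_zero_or_eq_half H.symm with H' | H'
      exacts [hr0 H', hrh H']
    have hrhneg : r + h ≠ -r := by
      intro H
      apply hne
      rw [← hmh]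
      linear_combination (m : ZMod (2 * h)) * H - 2 * hmr
    have hdisj : Disjoint M (M.image (· + (h : ZMod (2 * h)))) := by
      rw [Finset.disjoint_left]
      intro x hx hx'
      obtain ⟨y, hy, rfl⟩ := Finset.mem_image.1 hx'
      exact hMdiff _ hx _ hy rfl
    have hMneg : ∀ x, -x ∈ M → x ∈ M := fun x hx => by simpa using hMsym _ hx
    have hshift : ∀ x, x ∈ M.image (· + (h : ZMod (2 * h))) → x + h ∈ M := by
      intro x hx
      obtain ⟨y, hy, rfl⟩ := Finset.mem_image.1 hx
      rwa [add_assoc, hzero, add_zero]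
    have hdisj' : Disjoint (M ∪ M.image (· + (h : ZMod (2 * h))))
        {0, (h : ZMod (2 * h)), r, -r, r + h} := by
      have h0M : (0 : ZMod (2 * h)) ∉ M := fun H => h0 (hMS H)
      have hhM : (h : ZMod (2 * h)) ∉ M := fun H => hinv (hMS H)
      rw [Finset.disjoint_right]
      intro x hx hxM
      have hx' : x ∈ M ∨ x + h ∈ M := (Finset.mem_union.1 hxM).imp_right (hshift x)
      simp only [Finset.mem_insert, Finset.mem_singleton] at hx
      rcases hx with rfl | rfl | rfl | rfl | rfl
      · rw [zero_add] at hx'; tauto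
      · rw [hzero] at hx'; tauto
      · tauto
      · rcases hx' with hx' | hx'
        · exact hrM (hMneg _ hx')
        · refine hrhM (hMneg _ ?_)
          convert hx' using 1
          linear_combination -hzero
      · rw [add_assoc, hzero, add_zero] at hx'; tauto
    have hfive : ({0, (h : ZMod (2 * h)), r, -r, r + h} : Finset (ZMod (2 * h))).card = 5 := by
      have e1 : (h : ZMod (2 * h)) ≠ -r := fun H => hrh (by linear_combination H - hzero)
      have e2 : 0 ≠ r + (h : ZMod (2 * h)) := fun H => hrh (by linear_combination -H - hzero)
      have e3 : r ≠ r + h := fun H => hne (by linear_combination -H)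
      have e4 : (h : ZMod (2 * h)) ≠ r + h := fun H => hr0 (by linear_combination -H)
      have e5 : 0 ≠ -r := fun H => hr0 (by linear_combination H)
      rw [Finset.card_insert_of_notMem, Finset.card_insert_of_notMem,
        Finset.card_insert_of_notMem, Finset.card_insert_of_notMem, Finset.card_singleton]
      all_goals simp only [Finset.mem_insert, Finset.mem_singleton, not_or]
      · exact hrhneg.symm
      · exact ⟨hrneg, e3⟩
      · exact ⟨hrh.symm, e1, e4⟩
      · exact ⟨hne.symm, hr0.symm, e5, e2⟩
    have hle := Finset.card_le_univ ((M ∪ M.image (· + (h : ZMod (2 * h)))) ∪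
      {0, (h : ZMod (2 * h)), r, -r, r + h})
    rw [Finset.card_union_of_disjoint hdisj', Finset.card_union_of_disjoint hdisj, hfive,
      Finset.card_image_of_injective _ (add_left_injective _), ZMod.card, hMcard] at hle
    omega
  let φ : ZMod (2 * h) → ZMod (2 * h) := fun x =>
    if x + h ∈ S ∧ (m : ZMod (2 * h)) * (x + h) = 0 then x + h else x
  have hφ : ∀ x, φ x = x ∨ φ x = x + h := fun x => by
    simp only [φ]; split_ifs <;> simp
  have hφS : ∀ x ∈ M, φ x ∈ S := fun x hx => by
    simp only [φ]; split_ifs with H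
    · exact H.1
    · exact hMS hx
  have hφneg : ∀ x, φ (-x) = -φ x := by
    intro x
    have hx : -x + (h : ZMod (2 * h)) = -(x + h) := by linear_combination hzero
    have hS : -(x + h) ∈ S ↔ x + h ∈ S := ⟨fun H => by simpa using hsym _ H, hsym _⟩
    simp only [φ, hx, hS, mul_neg, neg_eq_zero]
    split_ifs <;> rfl
  refine ⟨M.image φ, ?_, ?_, ?_, ?_, ?_⟩
  · intro x hx
    obtain ⟨y, hy, rfl⟩ := Finset.mem_image.1 hx
    exact hφS y hy
  · intro x hx
    obtain ⟨y, hy, rfl⟩ := Finset.mem_image.1 hx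
    exact Finset.mem_image.2 ⟨-y, hMsym y hy, hφneg y⟩
  · refine Finset.card_image_of_injOn fun x hx y hy hxy => ?_
    rcases hφ x with H | H <;> rcases hφ y with H' | H' <;> rw [H, H'] at hxy
    · exact hxy
    · exact absurd hxy (hMdiff x hx y hy)
    · exact absurd hxy.symm (hMdiff y hy x hx)
    · exact add_left_injective _ hxy
  · intro x hx y hy hxy
    obtain ⟨u, hu, rfl⟩ := Finset.mem_image.1 hx
    obtain ⟨v, hv, rfl⟩ := Finset.mem_image.1 hy
    by_cases huv : u = -v
    · rw [huv, hφneg, neg_add_cancel] at hxy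
      exact hne hxy.symm
    · rcases hφ u with H | H <;> rcases hφ v with H' | H' <;> rw [H, H'] at hxy
      · exact hMsum u hu v hv hxy
      · exact huv (by linear_combination hxy)
      · exact huv (by linear_combination hxy)
      · exact hMsum u hu v hv (by linear_combination hxy - hzero)
  · intro r hr hmr
    obtain ⟨hrS, hrN⟩ := Finset.mem_sdiff.1 hr
    refine hrN (Finset.mem_image.2 ?_)
    rcases hcover r hrS hmr with hrM | hrM
    · refine ⟨r, hrM, if_neg fun H => hne ?_⟩
      rw [← hmh]
      linear_combination H.2 - hmr
    · have hrr : r + h + (h : ZMod (2 * h)) = r := by rw [add_assoc, hzero, add_zero]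
      refine ⟨r + h, hrM, ?_⟩
      simp only [φ, hrr]
      exact if_pos ⟨hrS, hmr⟩

/-- Theorem 3.3: a circulant graph of even order `n` with `n/2 ∉ S`, having a symmetric
subset `M ⊆ S` with `|M| = n/2 - 2` and `m + m' ≠ n/2` for all `m, m' ∈ M`, such that
`S \ M` generates `ZMod n`, has `χ''(G) ≤ Δ + 3`. -/
theorem circulant_delta_plus_three (n : ℕ) (hn : 0 < n) (heven : Even n)
    (S : Finset (ZMod n)) (hsym : ∀ s ∈ S, -s ∈ S) (h0 : (0 : ZMod n) ∉ S)
    (hinv : ((n / 2 : ℕ) : ZMod n) ∉ S)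
    (M : Finset (ZMod n)) (hMS : M ⊆ S) (hMsym : ∀ a ∈ M, -a ∈ M)
    (hMcard : M.card = n / 2 - 2)
    (hMsum : ∀ a ∈ M, ∀ b ∈ M, a + b ≠ ((n / 2 : ℕ) : ZMod n))
    (hgen : AddSubgroup.closure ((↑S : Set (ZMod n)) \ (↑M : Set (ZMod n))) = ⊤) :
    totalChromaticNumber (cayley n S) ≤ S.card + 3 := by
  obtain ⟨h, rfl⟩ := heven.two_dvd
  rw [Nat.mul_div_cancel_left h two_pos] at hinv hMcard hMsum
  have : NeZero (2 * h) := ⟨hn.ne'⟩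
  obtain ⟨a, m, hm, hnm⟩ := Nat.exists_eq_two_pow_mul_odd hn.ne'
  by_cases hh : h = 1
  · subst hh
    have hS : S = ∅ := by
      refine Finset.eq_empty_of_forall_notMem fun x hx => ?_
      have hx2 : x = 0 ∨ x = ((1 : ℕ) : ZMod (2 * 1)) := by
        clear hx; revert x; decide
      rcases hx2 with rfl | rfl
      exacts [h0 hx, hinv hx]
    subst hS
    rw [Finset.coe_empty, Set.empty_sdiff, AddSubgroup.closure_empty] at hgen
    have : (1 : ZMod (2 * 1)) ∈ (⊥ : AddSubgroup (ZMod (2 * 1))) := hgen ▸ AddSubgroup.mem_top _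
    exact absurd (AddSubgroup.mem_bot.1 this) (by decide)
  have hMeven : Even M.card := by
    refine even_card_of_neg_mem M hMsym fun x hx H => ?_
    rcases eq_zero_or_eq_half H with rfl | rfl
    exacts [h0 (hMS hx), hinv (hMS hx)]
  have hheven : Even h := by
    rw [hMcard] at hMeven
    obtain ⟨k, hk⟩ := hMeven
    exact ⟨k + 1, by omega⟩
  obtain ⟨N, hNS, hNsym, hNcard, hNsum, hN⟩ :=
    exists_exchange hm hsym h0 hinv hMS hMsym hMcard hMsum
  refine totalChromaticNumber_cayley_le hheven hnm hsym h0 hinv hNsym hNsum hN ?_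
  have := Finset.card_le_card hNS
  rw [Finset.card_sdiff_of_subset hNS]
  omega
end
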